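/- Let V and E be finite sets, let v₁, v₂ : E → V be maps with v₁(e) ≠ v₂(e) for every e ∈ E, and let A be an abelian group. Define d : (E → A) → (V → A) by d(m)(i) = ∑_{e : v₁(e) = i} m(e) − ∑_{e : v₂(e) = i} m(e), and for m : E → A and i ∈ V define D^m_i : E → A by D^m_i(e) = m(e) if v₁(e) = i, D^m_i(e) = −m(e) if v₂(e) = i, and D^m_i(e) = 0 otherwise. Then the assignment m ↦ (D^m_i)_{i ∈ V} is a bijection from the kernel of d onto the set of families (D_i)_{i ∈ V} of functions E → A satisfying the three conditions: (a) D_i(e) = 0 whenever i ∉ {v₁(e), v₂(e)}; (b) ∑_{i ∈ V} D_i(e) = 0 for every e ∈ E; and (c) ∑_{e ∈ E} D_i(e) = 0 for every i ∈ V. -/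

import Mathlib

/-- **Homology of an oriented graph and families of degree-zero divisors.**
Let `(V, E, v₁, v₂)` be a finite oriented graph without loops and `A` an abelian
group.  The map sending `m : E → A` to the family of "divisors"
`D^m_i (e) = m e` if `v₁ e = i`, `-m e` if `v₂ e = i`, and `0` otherwise, is a
bijection from the kernel of the boundary map
`d m i = ∑_{v₁ e = i} m e - ∑_{v₂ e = i} m e` onto the set of families
`(D_i)_{i ∈ V}` such that (a) `D_i e = 0` unless `i ∈ {v₁ e, v₂ e}`,
(b) `∑_i D_i e = 0` for every edge `e`, and (c) `∑_e D_i e = 0` for each `i`. -/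
theorem graph_homology_bijOn_divisor_families
    {V E : Type*} [Fintype V] [Fintype E] [DecidableEq V]
    (v₁ v₂ : E → V) (hne : ∀ e, v₁ e ≠ v₂ e)
    (A : Type*) [AddCommGroup A] :
    Set.BijOn
      (fun (m : E → A) => fun (i : V) (e : E) =>
        if v₁ e = i then m e else if v₂ e = i then -m e else 0)
      {m : E → A | ∀ i : V,
        (∑ e : E, if v₁ e = i then m e else 0) -
          (∑ e : E, if v₂ e = i then m e else 0) = 0}
      {D : V → E → A |
        (∀ (i : V) (e : E), i ≠ v₁ e → i ≠ v₂ e → D i e = 0) ∧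
        (∀ e : E, ∑ i : V, D i e = 0) ∧
        (∀ i : V, ∑ e : E, D i e = 0)} := by
  have split (m : E → A) (i : V) (e : E) :
      (if v₁ e = i then m e else if v₂ e = i then -m e else 0) =
        (if v₁ e = i then m e else 0) - (if v₂ e = i then m e else 0) := by
    have := hne e
    split_ifs <;> simp_all
  refine ⟨fun m hm => ⟨fun i e h₁ h₂ => ?_, fun e => ?_, fun i => ?_⟩,
    fun m _ m' _ h => ?_, fun D ⟨hsupp, hedge, hvertex⟩ => ?_⟩
  · simp [h₁.symm, h₂.symm]
  · simp [split]
  · simpa only [split, Finset.sum_sub_distrib] using hm i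
  · funext e
    simpa using congrFun (congrFun h (v₁ e)) e
  · have hD : (fun (i : V) (e : E) =>
        if v₁ e = i then D (v₁ e) e else if v₂ e = i then -D (v₁ e) e else 0) = D := by
      funext i e
      have hsum : D (v₁ e) e + D (v₂ e) e = 0 := by
        rw [← hedge e]
        exact (Fintype.sum_eq_add _ _ (hne e) fun i hi => hsupp i e hi.1 hi.2).symm
      split_ifs with h₁ h₂
      · rw [h₁]
      · rw [← h₂, neg_eq_of_add_eq_zero_right hsum]
      · exact (hsupp i e (Ne.symm h₁) (Ne.symm h₂)).symm
    refine ⟨fun e => D (v₁ e) e, fun i => ?_, hD⟩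
    rw [← Finset.sum_sub_distrib]
    refine Eq.trans (Finset.sum_congr rfl fun e _ => ?_) (hvertex i)
    rw [← split (fun e => D (v₁ e) e) i e]
    exact congrFun (congrFun hD i) e
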